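/- If V is an indecomposable e(2)-module, then its set of weights is a set of consecutive integers: for all integers j ≤ k ≤ m, if V_j ≠ 0 and V_m ≠ 0 then V_k ≠ 0. -/

import Mathlib

/-- An `e(2)`-module: a finite-dimensional complex vector space `V` with endomorphisms
`Pp = P₊`, `Pm = P₋`, `L` satisfying `P₊∘P₋ = P₋∘P₊`, `L∘P₊ − P₊∘L = P₊`,
`L∘P₋ − P₋∘L = −P₋`, such that `V` is the internal direct sum of the eigenspaces
`V_k = ker (L − k·id)`, `k ∈ ℤ`. -/
structure E2Mod : Type 1 where
  V : Type
  [acg : AddCommGroup V]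
  [mod : Module ℂ V]
  [fd : FiniteDimensional ℂ V]
  Pp : V →ₗ[ℂ] V
  Pm : V →ₗ[ℂ] V
  L : V →ₗ[ℂ] V
  comm : Pp.comp Pm = Pm.comp Pp
  relp : L.comp Pp - Pp.comp L = Pp
  relm : L.comp Pm - Pm.comp L = -Pm
  internal : DirectSum.IsInternal fun k : ℤ =>
    LinearMap.ker (L - (k : ℂ) • (LinearMap.id : V →ₗ[ℂ] V))

attribute [instance] E2Mod.acg E2Mod.mod E2Mod.fd

namespace E2Mod

/-- The `k`-weight space `V_k = ker (L - k·id)`. -/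
def wt (M : E2Mod) (k : ℤ) : Submodule ℂ M.V :=
  LinearMap.ker (M.L - (k : ℂ) • (LinearMap.id : M.V →ₗ[ℂ] M.V))

/-- A subspace is a submodule if it is invariant under `P₊`, `P₋` and `L`. -/
def IsSubmod (M : E2Mod) (S : Submodule ℂ M.V) : Prop :=
  (∀ v ∈ S, M.Pp v ∈ S) ∧ (∀ v ∈ S, M.Pm v ∈ S) ∧ (∀ v ∈ S, M.L v ∈ S)

/-- An `e(2)`-module is indecomposable if it is nonzero and admits no nontrivial
decomposition as an internal direct sum of two submodules. -/
def Indecomposable (M : E2Mod) : Prop :=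
  (∃ v : M.V, v ≠ 0) ∧
    ∀ W₁ W₂ : Submodule ℂ M.V, M.IsSubmod W₁ → M.IsSubmod W₂ →
      W₁ ⊓ W₂ = ⊥ → W₁ ⊔ W₂ = ⊤ → W₁ = ⊥ ∨ W₂ = ⊥

/-- Isomorphism of `e(2)`-modules: a bijective linear map commuting with `P₊, P₋, L`. -/
def Iso (M N : E2Mod) : Prop :=
  ∃ e : M.V ≃ₗ[ℂ] N.V,
    (∀ v, e (M.Pp v) = N.Pp (e v)) ∧ (∀ v, e (M.Pm v) = N.Pm (e v)) ∧
      (∀ v, e (M.L v) = N.L (e v))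

end E2Mod

namespace E2Mod

variable (M : E2Mod)

theorem mem_wt {k : ℤ} {v : M.V} : v ∈ M.wt k ↔ M.L v = (k : ℂ) • v := by
  simp [wt, sub_eq_zero]

theorem Pp_mem_wt {k : ℤ} {v : M.V} (hv : v ∈ M.wt k) : M.Pp v ∈ M.wt (k + 1) := by
  rw [mem_wt] at hv ⊢
  have h := LinearMap.congr_fun M.relp v
  simp only [LinearMap.sub_apply, LinearMap.comp_apply, hv, map_smul, sub_eq_iff_eq_add] at h
  rw [h, Int.cast_add, Int.cast_one, add_smul, one_smul, add_comm]

theorem Pm_mem_wt {k : ℤ} {v : M.V} (hv : v ∈ M.wt k) : M.Pm v ∈ M.wt (k - 1) := by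
  rw [mem_wt] at hv ⊢
  have h := LinearMap.congr_fun M.relm v
  simp only [LinearMap.sub_apply, LinearMap.comp_apply, LinearMap.neg_apply, hv, map_smul,
    sub_eq_iff_eq_add] at h
  rw [h, Int.cast_sub, Int.cast_one, sub_smul, one_smul, neg_add_eq_sub]

theorem iSupIndep_wt : iSupIndep M.wt :=
  M.internal.submodule_iSupIndep

theorem iSup_wt : ⨆ i, M.wt i = ⊤ :=
  M.internal.submodule_iSup_eq_top

/-- The sum of the weight spaces over a set of weights stable under `± 1`, up to zero weight
spaces, is a submodule. -/
theorem isSubmod_biSup_wt (S : Set ℤ) (hp : ∀ i ∈ S, i + 1 ∈ S ∨ M.wt (i + 1) = ⊥)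
    (hm : ∀ i ∈ S, i - 1 ∈ S ∨ M.wt (i - 1) = ⊥) : M.IsSubmod (⨆ i ∈ S, M.wt i) := by
  have le_of {i : ℤ} (h : i ∈ S ∨ M.wt i = ⊥) : M.wt i ≤ ⨆ i ∈ S, M.wt i :=
    h.elim (fun h ↦ le_biSup M.wt h) (fun h ↦ h ▸ bot_le)
  have invariant (f : M.V →ₗ[ℂ] M.V) (hf : ∀ i ∈ S, ∀ v ∈ M.wt i, f v ∈ ⨆ i ∈ S, M.wt i) :
      ∀ v ∈ ⨆ i ∈ S, M.wt i, f v ∈ ⨆ i ∈ S, M.wt i :=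
    iSup₂_le (a := (⨆ i ∈ S, M.wt i).comap f) hf
  refine ⟨invariant _ fun i hi v hv ↦ ?_, invariant _ fun i hi v hv ↦ ?_,
    invariant _ fun i hi v hv ↦ ?_⟩
  · exact le_of (hp i hi) (M.Pp_mem_wt hv)
  · exact le_of (hm i hi) (M.Pm_mem_wt hv)
  · rw [M.mem_wt.1 hv]
    exact Submodule.smul_mem _ _ (le_of (.inl hi) hv)

end E2Mod

/-- The set of weights of an indecomposable `e(2)`-module is a set of consecutive
integers. -/
theorem stmt_4 (M : E2Mod) (hM : M.Indecomposable) :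
    ∀ j k m : ℤ, j ≤ k → k ≤ m → M.wt j ≠ ⊥ → M.wt m ≠ ⊥ → M.wt k ≠ ⊥ := by
  intro j k m hjk hkm hj hm hk
  have hjk' : j < k := hjk.lt_of_ne (by rintro rfl; exact hj hk)
  have hkm' : k < m := hkm.lt_of_ne (by rintro rfl; exact hm hk)
  have eq_bot {i : ℤ} (h : i = k) : M.wt i = ⊥ := by rw [h, hk]
  have hlo : M.IsSubmod (⨆ i ∈ Set.Iio k, M.wt i) := by
    refine M.isSubmod_biSup_wt _ (fun i hi ↦ ?_) (fun i hi ↦ .inl ?_)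
    · rw [Set.mem_Iio] at hi ⊢
      exact (Int.add_one_le_of_lt hi).lt_or_eq.imp id eq_bot
    · rw [Set.mem_Iio] at hi ⊢
      lia
  have hhi : M.IsSubmod (⨆ i ∈ Set.Ioi k, M.wt i) := by
    refine M.isSubmod_biSup_wt _ (fun i hi ↦ .inl ?_) (fun i hi ↦ ?_)
    · rw [Set.mem_Ioi] at hi ⊢
      lia
    · rw [Set.mem_Ioi] at hi ⊢
      exact (Int.le_sub_one_of_lt hi).lt_or_eq.imp id fun h ↦ eq_bot h.symm
  have hdisj : (⨆ i ∈ Set.Iio k, M.wt i) ⊓ (⨆ i ∈ Set.Ioi k, M.wt i) = ⊥ :=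
    (M.iSupIndep_wt.disjoint_biSup_biSup
      ((Set.Iic_disjoint_Ioi le_rfl).mono_left Set.Iio_subset_Iic_self)).eq_bot
  have hsup : (⨆ i ∈ Set.Iio k, M.wt i) ⊔ (⨆ i ∈ Set.Ioi k, M.wt i) = ⊤ := by
    rw [eq_top_iff, ← M.iSup_wt]
    refine iSup_le fun i ↦ ?_
    rcases lt_trichotomy i k with h | h | h
    · exact le_sup_of_le_left (le_biSup M.wt (Set.mem_Iio.2 h))
    · exact (eq_bot h).le.trans bot_le
    · exact le_sup_of_le_right (le_biSup M.wt (Set.mem_Ioi.2 h))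
  rcases hM.2 _ _ hlo hhi hdisj hsup with h | h
  · exact hj (le_bot_iff.1 ((le_biSup M.wt (Set.mem_Iio.2 hjk')).trans h.le))
  · exact hm (le_bot_iff.1 ((le_biSup M.wt (Set.mem_Ioi.2 hkm')).trans h.le))
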